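/- Let σ ∈ Σ_n be a permutation that is neither the identity permutation nor the decreasing permutation (σ(j) = n+1−j), let f be a maximal flag in F^n with label σ, let t_σ be the smallest ascent of σ, and let V be the t_σ-th subspace of f (the subspace in f of dimension t_σ). Then minlabel({V}) is lexicographically strictly smaller than σ. -/

import Mathlib

open Matrix

variable {n : ℕ} {F : Type} [Field F]

/-- `(r, j)` is a pivot position of `M`: the entry `M r j` is nonzero and all entries of
column `j` strictly below row `r` vanish (i.e. `r` is the largest row index with `M r j ≠ 0`). -/
def IsPivot (M : Matrix (Fin n) (Fin n) F) (r j : Fin n) : Prop :=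
  M r j ≠ 0 ∧ ∀ r' : Fin n, r < r' → M r' j = 0

/-- The span of the first `j` columns of `M` (columns with index `< j` in 0-based indexing). -/
def colSpan (M : Matrix (Fin n) (Fin n) F) (j : ℕ) : Submodule F (Fin n → F) :=
  Submodule.span F ((fun i : Fin n => Mᵀ i) '' {i : Fin n | (i : ℕ) < j})

/-- A flag: a nonempty finite set of proper nonzero subspaces of `F^n` forming a chain. -/
def IsFlag (g : Set (Submodule F (Fin n → F))) : Prop :=
  g.Finite ∧ g.Nonempty ∧ IsChain (· ≤ ·) g ∧ ∀ V ∈ g, V ≠ ⊥ ∧ V ≠ ⊤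

/-- A maximal flag: a flag containing a subspace of every dimension `1,…,n-1`. -/
def IsMaximalFlag (f : Set (Submodule F (Fin n → F))) : Prop :=
  IsFlag f ∧ ∀ j : ℕ, 1 ≤ j → j ≤ n - 1 → ∃ V ∈ f, Module.finrank F V = j

/-- Conditions (i)–(iii) for a matrix representation of a flag `f`:
(i) for every `V ∈ f` the first `dim V` columns of `M` span `V`, and all `n` columns span `F^n`;
(ii) every pivot entry equals `1`;
(iii) entries in the same row as a pivot and strictly to its right vanish. -/
def IsRep (f : Set (Submodule F (Fin n → F))) (M : Matrix (Fin n) (Fin n) F) : Prop :=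
  (∀ V ∈ f, colSpan M (Module.finrank F V) = V) ∧
  colSpan M n = ⊤ ∧
  (∀ r j : Fin n, IsPivot M r j → M r j = 1) ∧
  (∀ r j j' : Fin n, IsPivot M r j → j < j' → M r j' = 0)

/-- Columns `i` and `i'` lie in the same block of the block decomposition induced by the
flag `g` (blocks are the intervals of columns between consecutive dimensions of members of `g`). -/
def SameBlock (g : Set (Submodule F (Fin n → F))) (i i' : Fin n) : Prop :=
  ∀ V ∈ g, ((i : ℕ) < Module.finrank F V ↔ (i' : ℕ) < Module.finrank F V)

/-- The minimal matrix representation of a flag `g`: conditions (i)–(iii) together with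
(iv) within each block, entries in the same row as a pivot of the block and strictly to its left
within the block vanish; (v) within each block, pivot row indices strictly increase. -/
def IsMinRep (g : Set (Submodule F (Fin n → F))) (M : Matrix (Fin n) (Fin n) F) : Prop :=
  IsRep g M ∧
  (∀ r i i' : Fin n, SameBlock g i i' → IsPivot M r i → i' < i → M r i' = 0) ∧
  (∀ r r' i i' : Fin n, SameBlock g i i' → IsPivot M r i → IsPivot M r' i' → i < i' → r < r')

/-- `σ` is the label of the maximal flag `f`: `σ j` is the pivot row of the `j`-th column of
the minimal matrix representation of `f`. -/
def IsLabel (f : Set (Submodule F (Fin n → F))) (σ : Equiv.Perm (Fin n)) : Prop :=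
  ∃ M : Matrix (Fin n) (Fin n) F, IsRep f M ∧ ∀ j : Fin n, IsPivot M (σ j) j

/-- Strict lexicographic order on permutations in one-line notation `(σ 0, …, σ (n-1))`. -/
def LexLt {n : ℕ} (σ τ : Equiv.Perm (Fin n)) : Prop :=
  ∃ j : Fin n, (∀ i : Fin n, i < j → σ i = τ i) ∧ σ j < τ j

/-- `σ` is the lexicographically least label among the labels of maximal flags containing `g`. -/
def IsMinlabel (g : Set (Submodule F (Fin n → F))) (σ : Equiv.Perm (Fin n)) : Prop :=
  (∃ f, IsMaximalFlag f ∧ g ⊆ f ∧ IsLabel f σ) ∧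
  ∀ (f : Set (Submodule F (Fin n → F))) (τ : Equiv.Perm (Fin n)),
    IsMaximalFlag f → g ⊆ f → IsLabel f τ → σ = τ ∨ LexLt σ τ

/-- `t` is a (0-based) ascent of `σ`: `σ t < σ (t+1)`.  (In the 1-based indexing of the paper
this corresponds to the ascent `(σ(t+1), σ(t+2))` at position `t+1`.) -/
def Ascent {n : ℕ} (σ : Equiv.Perm (Fin n)) (t : ℕ) : Prop :=
  ∃ h : t + 1 < n, σ ⟨t, Nat.lt_of_succ_lt h⟩ < σ ⟨t + 1, h⟩

/-- `σ` is the decreasing permutation `σ(j) = n + 1 - j` (in 0-based indexing, `n - 1 - j`). -/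
def IsDecreasing {n : ℕ} (σ : Equiv.Perm (Fin n)) : Prop :=
  ∀ j : Fin n, (σ j : ℕ) = n - 1 - (j : ℕ)

theorem LexLt.trans {n : ℕ} {σ τ ρ : Equiv.Perm (Fin n)} (h₁ : LexLt σ τ) (h₂ : LexLt τ ρ) :
    LexLt σ ρ := by
  obtain ⟨i, hi, hi'⟩ := h₁
  obtain ⟨j, hj, hj'⟩ := h₂
  rcases lt_trichotomy i j with h | rfl | h
  · exact ⟨i, fun l hl => (hi l hl).trans (hj l (hl.trans h)), hj i h ▸ hi'⟩
  · exact ⟨i, fun l hl => (hi l hl).trans (hj l hl), hi'.trans hj'⟩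
  · exact ⟨j, fun l hl => (hi l (hl.trans h)).trans (hj l hl), (hi j h).symm ▸ hj'⟩

theorem lexLt_mul_swap {n : ℕ} {σ : Equiv.Perm (Fin n)} {p q : Fin n} (hpq : p < q)
    (h : σ q < σ p) : LexLt (σ * Equiv.swap p q) σ := by
  refine ⟨p, fun i hi => ?_, by simpa using h⟩
  rw [Equiv.Perm.mul_apply, Equiv.swap_apply_of_ne_of_ne hi.ne (hi.trans hpq).ne]

theorem exists_descent_of_ne_one {n : ℕ} {σ : Equiv.Perm (Fin n)} (hσ : σ ≠ 1) :
    ∃ p q : Fin n, (q : ℕ) = p + 1 ∧ σ q < σ p := by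
  by_contra! h
  refine hσ (Equiv.ext fun i => ?_)
  have hmono : StrictMono σ := by
    cases n with
    | zero => exact fun i => i.elim0
    | succ m =>
      refine Fin.strictMono_iff_lt_succ.2 fun i => lt_of_le_of_ne (h _ _ (by simp)) fun e => ?_
      exact (Fin.castSucc_lt_succ (i := i)).ne (σ.injective e)
  have := Subsingleton.elim (hmono.orderIsoOfSurjective σ σ.surjective) (OrderIso.refl _)
  exact congrArg (fun e : Fin n ≃o Fin n => e i) this

theorem IsPivot.unique {M : Matrix (Fin n) (Fin n) F} {r r' j : Fin n}
    (h : IsPivot M r j) (h' : IsPivot M r' j) : r = r' := by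
  rcases lt_trichotomy r r' with hl | e | hl
  · exact absurd (h.2 _ hl) h'.1
  · exact e
  · exact absurd (h'.2 _ hl) h.1

theorem col_mem_colSpan (M : Matrix (Fin n) (Fin n) F) {i : Fin n} {j : ℕ} (h : (i : ℕ) < j) :
    Mᵀ i ∈ colSpan M j :=
  Submodule.subset_span ⟨i, h, rfl⟩

theorem colSpan_mono (M : Matrix (Fin n) (Fin n) F) : Monotone (colSpan M) := fun _ _ h =>
  Submodule.span_mono (Set.image_mono fun _ hi => lt_of_lt_of_le hi h)

theorem finrank_colSpan {M : Matrix (Fin n) (Fin n) F} (hM : colSpan M n = ⊤) {j : ℕ}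
    (hj : j ≤ n) : Module.finrank F (colSpan M j) = j := by
  have hli : LinearIndependent F (fun i : Fin n => Mᵀ i) := by
    refine linearIndependent_of_top_le_span_of_card_eq_finrank ?_ (by simp)
    rw [← hM]
    exact Submodule.span_mono (Set.image_subset_range _ _)
  have hli' := hli.comp (Fin.castLE hj) (Fin.castLE_injective hj)
  have hrange : colSpan M j =
      Submodule.span F (Set.range ((fun i : Fin n => Mᵀ i) ∘ Fin.castLE hj)) := by
    rw [colSpan, Set.range_comp]
    congr 2
    ext i
    simp
  rw [hrange, finrank_span_eq_card hli', Fintype.card_fin]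

/-- A matrix whose columns span `F^n` represents the flag of its proper nonzero column spans. -/
theorem isMaximalFlag_colSpan (hn : 2 ≤ n) {M : Matrix (Fin n) (Fin n) F}
    (hM : colSpan M n = ⊤) : IsMaximalFlag (colSpan M '' Set.Icc 1 (n - 1)) := by
  refine ⟨⟨(Set.finite_Icc _ _).image _, ⟨_, 1, ⟨le_rfl, by omega⟩, rfl⟩, ?_, ?_⟩, ?_⟩
  · rintro _ ⟨i, -, rfl⟩ _ ⟨j, -, rfl⟩ -
    exact (le_total i j).imp (fun h => colSpan_mono M h) (fun h => colSpan_mono M h)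
  · rintro _ ⟨j, ⟨hj, hj'⟩, rfl⟩
    have hr := finrank_colSpan hM (j := j) (by omega)
    constructor <;> intro e <;> rw [e] at hr
    · rw [finrank_bot] at hr
      omega
    · rw [finrank_top, Module.finrank_fin_fun] at hr
      omega
  · exact fun j hj hj' => ⟨_, ⟨j, ⟨hj, hj'⟩, rfl⟩, finrank_colSpan hM (by omega)⟩

/-- Column operation exchanging columns `p` and `q` and then clearing the entry of the new
column `q` in row `r`, assuming that `M r q = 1`. -/
def swapClear (M : Matrix (Fin n) (Fin n) F) (p q r : Fin n) : Matrix (Fin n) (Fin n) F :=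
  fun i j => M i (Equiv.swap p q j) - if j = q then M r p * M i q else 0

section SwapClear

variable (M : Matrix (Fin n) (Fin n) F) {p q : Fin n} (r : Fin n)

theorem swapClear_apply_left (hpq : p ≠ q) (i : Fin n) : swapClear M p q r i p = M i q := by
  simp [swapClear, hpq]

theorem swapClear_apply_right (i : Fin n) :
    swapClear M p q r i q = M i p - M r p * M i q := by
  simp [swapClear]

theorem swapClear_apply_of_ne {j : Fin n} (hp : j ≠ p) (hq : j ≠ q) (i : Fin n) :
    swapClear M p q r i j = M i j := by
  simp [swapClear, hq, Equiv.swap_apply_of_ne_of_ne hp hq]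

theorem colSpan_swapClear (hpq : (q : ℕ) = p + 1) {j : ℕ} (hj : j ≠ q) :
    colSpan (swapClear M p q r) j = colSpan M j := by
  have hne : p ≠ q := fun e => by simp [e] at hpq
  have hleft : (swapClear M p q r)ᵀ p = Mᵀ q := funext fun i => swapClear_apply_left M r hne i
  have hright : (swapClear M p q r)ᵀ q = Mᵀ p - M r p • Mᵀ q :=
    funext fun i => swapClear_apply_right M r i
  have hother {i : Fin n} (hp : i ≠ p) (hq : i ≠ q) : (swapClear M p q r)ᵀ i = Mᵀ i :=
    funext fun _ => swapClear_apply_of_ne M r hp hq _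
  apply le_antisymm <;> refine Submodule.span_le.2 ?_ <;> rintro _ ⟨i, hi, rfl⟩ <;>
    replace hi : (i : ℕ) < j := hi <;> simp only [SetLike.mem_coe]
  · rcases eq_or_ne i p with rfl | hp
    · rw [hleft]
      exact col_mem_colSpan M (by omega)
    rcases eq_or_ne i q with rfl | hq
    · rw [hright]
      exact sub_mem (col_mem_colSpan M (by omega))
        (Submodule.smul_mem _ _ (col_mem_colSpan M hi))
    · rw [hother hp hq]
      exact col_mem_colSpan M hi
  · rcases eq_or_ne i p with rfl | hp
    · rw [show Mᵀ i = (swapClear M i q r)ᵀ q + M r i • (swapClear M i q r)ᵀ i by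
        rw [hleft, hright, sub_add_cancel]]
      exact add_mem (col_mem_colSpan _ (by omega))
        (Submodule.smul_mem _ _ (col_mem_colSpan _ hi))
    rcases eq_or_ne i q with rfl | hq
    · rw [← hleft]
      exact col_mem_colSpan _ (by omega)
    · rw [← hother hp hq]
      exact col_mem_colSpan _ hi

end SwapClear

/-- Exchanging two adjacent columns at a descent of the label `σ` yields a maximal flag with
label `σ * swap p q` which still contains all subspaces of dimension other than `q`. -/
theorem exists_flag_label_mul_swap (hn : 2 ≤ n) {f : Set (Submodule F (Fin n → F))}
    {σ : Equiv.Perm (Fin n)} (hf : IsMaximalFlag f) (hfσ : IsLabel f σ) {p q : Fin n}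
    (hpq : (q : ℕ) = p + 1) (hdesc : σ q < σ p) :
    ∃ g, IsMaximalFlag g ∧ IsLabel g (σ * Equiv.swap p q) ∧
      ∀ V ∈ f, Module.finrank F V ≠ q → V ∈ g := by
  obtain ⟨M, ⟨hspan, htop, hone, hzero⟩, hpiv⟩ := hfσ
  have hlt : p < q := Fin.lt_def.2 (by omega)
  have hne : p ≠ q := hlt.ne
  set N := swapClear M p q (σ q) with hN
  have hNspan {j : ℕ} (hj : j ≠ q) : colSpan N j = colSpan M j := colSpan_swapClear M _ hpq hj
  have hNtop : colSpan N n = ⊤ := (hNspan (by omega)).trans htop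
  have hNpiv_one (j : Fin n) : IsPivot N ((σ * Equiv.swap p q) j) j ∧
      N ((σ * Equiv.swap p q) j) j = 1 := by
    suffices h : N ((σ * Equiv.swap p q) j) j = 1 ∧
        ∀ r', (σ * Equiv.swap p q) j < r' → N r' j = 0 from
      ⟨⟨h.1 ▸ one_ne_zero, h.2⟩, h.1⟩
    rw [Equiv.Perm.mul_apply]
    rcases eq_or_ne j p with rfl | hjp
    · simp only [Equiv.swap_apply_left, hN, swapClear_apply_left M _ hne]
      exact ⟨hone _ _ (hpiv q), (hpiv q).2⟩
    rcases eq_or_ne j q with rfl | hjq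
    · simp only [Equiv.swap_apply_right, hN, swapClear_apply_right]
      refine ⟨by rw [hone _ _ (hpiv p), (hpiv j).2 _ hdesc, mul_zero, sub_zero], fun r' hr => ?_⟩
      rw [(hpiv p).2 _ hr, (hpiv j).2 _ (hdesc.trans hr), mul_zero, sub_zero]
    · simp only [Equiv.swap_apply_of_ne_of_ne hjp hjq, hN, swapClear_apply_of_ne M _ hjp hjq]
      exact ⟨hone _ _ (hpiv j), (hpiv j).2⟩
  have hNzero {j j' : Fin n} (h : j < j') : N ((σ * Equiv.swap p q) j) j' = 0 := by
    have hM {i i' : Fin n} (h : i < i') : M (σ i) i' = 0 := hzero _ _ _ (hpiv i) h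
    rw [Equiv.Perm.mul_apply]
    rcases eq_or_ne j' p with rfl | hjp
    · rw [Equiv.swap_apply_of_ne_of_ne h.ne (h.trans hlt).ne, hN, swapClear_apply_left M _ hne]
      exact hM (h.trans hlt)
    rcases eq_or_ne j' q with rfl | hjq
    · rw [hN, swapClear_apply_right]
      rcases eq_or_ne j p with rfl | hj
      · rw [Equiv.swap_apply_left, hone _ _ (hpiv j'), mul_one, sub_self]
      · rw [Equiv.swap_apply_of_ne_of_ne hj h.ne, hM h, hM (Fin.lt_def.2 (by omega)), mul_zero,
          sub_zero]
    · rw [hN, swapClear_apply_of_ne M _ hjp hjq]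
      apply hM
      rcases eq_or_ne j p with rfl | hj
      · rw [Equiv.swap_apply_left]
        exact Fin.lt_def.2 (by omega)
      rcases eq_or_ne j q with rfl | hj'
      · rw [Equiv.swap_apply_right]
        exact hlt.trans h
      · rwa [Equiv.swap_apply_of_ne_of_ne hj hj']
  refine ⟨_, isMaximalFlag_colSpan hn hNtop, ⟨N, ⟨?_, hNtop, ?_, ?_⟩, fun j => (hNpiv_one j).1⟩,
    fun V hV hVq => ⟨Module.finrank F V, ⟨?_, ?_⟩, (hNspan hVq).trans (hspan V hV)⟩⟩
  · rintro _ ⟨j, ⟨-, hj⟩, rfl⟩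
    rw [finrank_colSpan hNtop (by omega)]
  · intro r j h
    rw [h.unique (hNpiv_one j).1]
    exact (hNpiv_one j).2
  · intro r j j' h hj
    rw [h.unique (hNpiv_one j).1]
    exact hNzero hj
  · exact Submodule.one_le_finrank_iff.2 (hf.1.2.2.2 V hV).1
  · have := Submodule.finrank_lt (hf.1.2.2.2 V hV).2
    rw [Module.finrank_fin_fun] at this
    omega

/-- if `σ` is neither the identity nor the decreasing permutation, `f` is a
maximal flag with label `σ`, `t` is the smallest (0-based) ascent of `σ` and `V` is the
subspace of `f` of dimension `t+1` (the `t_σ`-th vertex of `f`), then `minlabel {V}` is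
lexicographically strictly smaller than `σ`. -/
theorem minlabel_of_special_vertex_lt
    [Fintype F] (hn : 2 ≤ n)
    (σ : Equiv.Perm (Fin n)) (hσ₁ : σ ≠ 1) (hσ₂ : ¬ IsDecreasing σ)
    (f : Set (Submodule F (Fin n → F))) (hf : IsMaximalFlag f) (hfσ : IsLabel f σ)
    (t : ℕ) (ht : Ascent σ t) (htmin : ∀ t' : ℕ, Ascent σ t' → t ≤ t')
    (V : Submodule F (Fin n → F)) (hV : V ∈ f) (hVdim : Module.finrank F V = t + 1)
    (τ : Equiv.Perm (Fin n)) (hτ : IsMinlabel {V} τ) :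
    LexLt τ σ := by
  obtain ⟨p, q, hpq, hdesc⟩ := exists_descent_of_ne_one hσ₁
  obtain ⟨g, hg, hgσ, hgV⟩ := exists_flag_label_mul_swap hn hf hfσ hpq hdesc
  have hpt : (p : ℕ) ≠ t := by
    rintro rfl
    obtain ⟨h, hasc⟩ := ht
    rw [show (⟨p + 1, h⟩ : Fin n) = q from Fin.ext hpq.symm] at hasc
    exact hasc.asymm hdesc
  have hlt := lexLt_mul_swap (Fin.lt_def.2 (by omega)) hdesc
  rcases hτ.2 g _ hg (Set.singleton_subset_iff.2 (hgV V hV (by omega))) hgσ with rfl | h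
  · exact hlt
  · exact h.trans hlt
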